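/- A finite simple graph G is in 𝒰 (that is, G supports an unsatisfiable simple 2-CNF) if and only if at least one of the four graphs — the butterfly, the bowtie, K₄, or K_{1,1,3} — is a topological minor of G. -/

import Mathlib

open SimpleGraph

namespace Sat2

abbrev Lit (V : Type) := V × Bool
abbrev TwoCNF (V : Type) := List (Lit V × Lit V)

/-- An assignment satisfies a 2-CNF if it satisfies at least one literal
of every clause. -/
def SatTwoCNF {V : Type} (τ : V → Bool) (S : TwoCNF V) : Prop :=
  ∀ c ∈ S, τ c.1.1 = c.1.2 ∨ τ c.2.1 = c.2.2

def TwoSatisfiable {V : Type} (S : TwoCNF V) : Prop := ∃ τ, SatTwoCNF τ S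

/-- The unordered pair of underlying variables of a 2-clause. -/
def clauseVars {V : Type} (c : Lit V × Lit V) : Sym2 V := s(c.1.1, c.2.1)

/-- A 2-CNF is simple if in every clause the two literals have distinct
underlying variables, and no two distinct clauses have the same unordered
pair of underlying variables. -/
def SimpleTwoCNF {V : Type} (S : TwoCNF V) : Prop :=
  (∀ c ∈ S, c.1.1 ≠ c.2.1) ∧ (S.map clauseVars).Nodup

/-- A 2-CNF `S` is supported on a simple graph `G` (with vertex type equal to
the variable type) when clause ↦ unordered pair of variables is a bijection
from the clauses of `S` onto the edges of `G`. -/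
def SupportedOn {V : Type} (S : TwoCNF V) (G : SimpleGraph V) : Prop :=
  (S.map clauseVars).Nodup ∧ {e : Sym2 V | e ∈ S.map clauseVars} = G.edgeSet

/-- `G ∈ 𝒰`: some unsatisfiable simple 2-CNF is supported on `G`. -/
def InU {V : Type} (G : SimpleGraph V) : Prop :=
  ∃ S : TwoCNF V, SimpleTwoCNF S ∧ SupportedOn S G ∧ ¬ TwoSatisfiable S

/-- `G` is isomorphic to a subgraph of `H`. -/
def IsSubgraphOf {α β : Type} (G : SimpleGraph α) (H : SimpleGraph β) : Prop :=
  ∃ f : α → β, Function.Injective f ∧ ∀ ⦃u v⦄, G.Adj u v → H.Adj (f u) (f v)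

/-- The graph obtained from `G` by subdividing the edge `(u, v)`:
the edge `(u,v)` is replaced by a path `u – w – v` through the
new vertex `w = none`. -/
def subdivideEdge {α : Type} (G : SimpleGraph α) (u v : α) :
    SimpleGraph (Option α) :=
  SimpleGraph.fromRel (fun a b =>
    match a, b with
    | some x, some y => G.Adj x y ∧ s(x, y) ≠ s(u, v)
    | some x, none => x = u ∨ x = v
    | _, _ => False)

/-- `IsSubdivision G H` : `H` is (up to starting isomorphism) obtained from `G`
by repeatedly subdividing edges. -/
inductive IsSubdivision : {α β : Type} → SimpleGraph α → SimpleGraph β → Prop where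
  | of_iso {α β : Type} {G : SimpleGraph α} {H : SimpleGraph β} :
      (G ≃g H) → IsSubdivision G H
  | step {α β : Type} {G : SimpleGraph α} {H : SimpleGraph β} (u v : β) :
      IsSubdivision G H → H.Adj u v → IsSubdivision G (subdivideEdge H u v)

/-- `G` is a topological minor of `H`: some subdivision of `G` is isomorphic
to a subgraph of `H`. -/
def IsTopMinor {α β : Type} (G : SimpleGraph α) (H : SimpleGraph β) : Prop :=
  ∃ (γ : Type) (G' : SimpleGraph γ), IsSubdivision G G' ∧ IsSubgraphOf G' H

/-- Contraction of the edge `(u,v)`: delete `v` and merge it into `u`. -/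
def contractEdge {α : Type} (G : SimpleGraph α) (u v : α) :
    SimpleGraph {w : α // w ≠ v} :=
  SimpleGraph.fromRel (fun a b =>
    G.Adj a.val b.val ∨ (a.val = u ∧ G.Adj v b.val) ∨ (b.val = u ∧ G.Adj a.val v))

/-- `ContractionSeq H G` : `G` can be obtained from `H` by a sequence of edge
contractions, each performed at an edge whose endpoints have no common
neighbor at the time of contraction. -/
inductive ContractionSeq : {α β : Type} → SimpleGraph α → SimpleGraph β → Prop where
  | of_iso {α β : Type} {H : SimpleGraph α} {G : SimpleGraph β} :
      (H ≃g G) → ContractionSeq H G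
  | step {α β : Type} {H : SimpleGraph α} {G : SimpleGraph β} (u v : α) :
      H.Adj u v → (∀ w, ¬(H.Adj u w ∧ H.Adj v w)) →
      ContractionSeq (contractEdge H u v) G → ContractionSeq H G

/-- The butterfly graph: two triangles sharing exactly one vertex. -/
def butterfly : SimpleGraph (Fin 5) :=
  SimpleGraph.fromEdgeSet {s(0,1), s(0,2), s(1,2), s(2,3), s(2,4), s(3,4)}

/-- The bowtie graph: two vertex-disjoint triangles joined by a single edge. -/
def bowtie : SimpleGraph (Fin 6) :=
  SimpleGraph.fromEdgeSet {s(0,1), s(0,2), s(1,2), s(2,3), s(3,4), s(3,5), s(4,5)}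

/-- The complete graph on four vertices. -/
def K4 : SimpleGraph (Fin 4) := ⊤

/-- The complete tripartite graph `K_{1,1,3}`, with parts {0}, {1}, {2,3,4}. -/
def K113 : SimpleGraph (Fin 5) :=
  SimpleGraph.fromEdgeSet {s(0,1), s(0,2), s(0,3), s(0,4), s(1,2), s(1,3), s(1,4)}

/-- The complete graph on four vertices with one edge deleted. -/
def K4minusE : SimpleGraph (Fin 4) :=
  SimpleGraph.fromEdgeSet {s(0,1), s(0,2), s(0,3), s(1,2), s(1,3)}

/-- `τ` falsifies no edge of `G`, where `p u v` is the value of `u` that falsifies its literal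
in the clause on the edge `uv`. -/
def Avoids {V : Type} (G : SimpleGraph V) (p : V → V → Bool) (τ : V → Bool) : Prop :=
  ∀ u v, G.Adj u v → τ u = p u v → τ v ≠ p v u

/-- Some choice of one clause on every edge of `G` is unsatisfiable. -/
def Unsat {V : Type} (G : SimpleGraph V) : Prop :=
  ∃ p : V → V → Bool, ∀ τ, ¬ Avoids G p τ

theorem unsat_of_inU {V : Type} {G : SimpleGraph V} (h : InU G) : Unsat G := by
  classical
  obtain ⟨S, ⟨hne, hnd⟩, ⟨-, hE⟩, hS⟩ := h
  refine ⟨fun u v => decide (∃ b, ((u, false), (v, b)) ∈ S ∨ ((v, b), (u, false)) ∈ S),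
    fun τ hτ => hS ⟨τ, ?_⟩⟩
  rintro ⟨⟨u, a⟩, ⟨v, b⟩⟩ hc
  have huv : u ≠ v := hne _ hc
  have hadj : G.Adj u v := by
    have : s(u, v) ∈ G.edgeSet := by
      rw [← hE]
      exact List.mem_map.2 ⟨_, hc, rfl⟩
    exact this
  have hinj := List.inj_on_of_nodup_map hnd
  by_contra hcon
  simp only [not_or] at hcon
  obtain ⟨ha, hb⟩ := hcon
  have hp : τ u = decide (∃ b, ((u, false), (v, b)) ∈ S ∨ ((v, b), (u, false)) ∈ S) := by
    cases a with
    | false =>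
      rw [decide_eq_true ⟨b, Or.inl hc⟩]
      simpa using ha
    | true =>
      rw [decide_eq_false]
      · simpa using ha
      · rintro ⟨b', h | h⟩
        · have := hinj hc h rfl
          simp at this
        · have := hinj hc h Sym2.eq_swap
          simp [huv] at this
  have hq : τ v = decide (∃ b, ((v, false), (u, b)) ∈ S ∨ ((u, b), (v, false)) ∈ S) := by
    cases b with
    | false =>
      rw [decide_eq_true ⟨a, Or.inr hc⟩]
      simpa using hb
    | true =>
      rw [decide_eq_false]
      · simpa using hb
      · rintro ⟨b', h | h⟩
        · have := hinj hc h Sym2.eq_swap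
          simp [huv] at this
        · have := hinj hc h rfl
          simp at this
  exact hτ u v hadj hp hq

theorem inU_of_unsat {V : Type} [Fintype V] {G : SimpleGraph V} (h : Unsat G) : InU G := by
  classical
  obtain ⟨p, hp⟩ := h
  let c : Sym2 V → Lit V × Lit V := fun e =>
    (((Quot.out e).1, !p (Quot.out e).1 (Quot.out e).2),
      ((Quot.out e).2, !p (Quot.out e).2 (Quot.out e).1))
  have hc : ∀ e, clauseVars (c e) = e := fun e => Quot.out_eq e
  have hmap : (G.edgeFinset.toList.map c).map clauseVars = G.edgeFinset.toList := by
    rw [List.map_map]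
    exact (List.map_congr_left fun e _ => hc e).trans (List.map_id _)
  have hnd : ((G.edgeFinset.toList.map c).map clauseVars).Nodup := by
    rw [hmap]
    exact Finset.nodup_toList _
  refine ⟨G.edgeFinset.toList.map c, ⟨?_, hnd⟩, ⟨hnd, ?_⟩, ?_⟩
  · intro d hd
    obtain ⟨e, he, rfl⟩ := List.mem_map.1 hd
    have he' : clauseVars (c e) ∈ G.edgeSet := by
      rw [hc]
      simpa using he
    exact G.ne_of_adj he'
  · rw [hmap]
    ext e
    simp
  · rintro ⟨τ, hτ⟩
    refine hp τ fun u v huv hu hv => ?_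
    have he : s(u, v) ∈ G.edgeFinset.toList := by simpa using huv
    have hs := hτ _ (List.mem_map.2 ⟨_, he, rfl⟩)
    have ho : s((Quot.out s(u, v)).1, (Quot.out s(u, v)).2) = s(u, v) := hc s(u, v)
    simp only [c] at hs
    rcases Sym2.eq_iff.1 ho with ⟨h1, h2⟩ | ⟨h1, h2⟩ <;> rw [h1, h2, hu, hv] at hs <;> simp at hs

theorem Unsat.of_isSubgraphOf {V W : Type} {G : SimpleGraph V} {H : SimpleGraph W}
    (h : Unsat G) (hGH : IsSubgraphOf G H) : Unsat H := by
  classical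
  obtain ⟨p, hp⟩ := h
  obtain ⟨f, hf, hadj⟩ := hGH
  rcases isEmpty_or_nonempty V with hV | hV
  · exact absurd (fun u => (hV.false u).elim) (hp fun _ => true)
  · refine ⟨fun x y => p (Function.invFun f x) (Function.invFun f y), fun τ hτ => hp (τ ∘ f) ?_⟩
    intro u v huv
    have := hτ (f u) (f v) (hadj huv)
    simpa only [Function.leftInverse_invFun hf _, Function.comp] using this

/-- The two clauses at a middle vertex can be satisfied unless both are reduced to units. -/
theorem exists_bool_avoiding (a b c d s t : Bool) (h : ¬ (s = c ∧ t = d)) :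
    ∃ x : Bool, (x = a → s ≠ c) ∧ (x = b → t ≠ d) := by
  revert a b c d s t
  decide

theorem subdivideEdge_adj_some_none {V : Type} {G : SimpleGraph V} {u v x : V} :
    (subdivideEdge G u v).Adj (some x) none ↔ x = u ∨ x = v := by
  simp [subdivideEdge]

theorem subdivideEdge_adj_none_some {V : Type} {G : SimpleGraph V} {u v x : V} :
    (subdivideEdge G u v).Adj none (some x) ↔ x = u ∨ x = v := by
  simp [subdivideEdge]

theorem subdivideEdge_adj_some_some {V : Type} {G : SimpleGraph V} {u v x y : V} :
    (subdivideEdge G u v).Adj (some x) (some y) ↔ G.Adj x y ∧ s(x, y) ≠ s(u, v) := by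
  simp only [subdivideEdge, SimpleGraph.fromRel_adj]
  constructor
  · rintro ⟨-, h | h⟩
    · exact h
    · exact ⟨h.1.symm, by rw [Sym2.eq_swap]; exact h.2⟩
  · exact fun h => ⟨by simpa using h.1.ne, Or.inl h⟩

theorem Unsat.subdivideEdge {V : Type} {G : SimpleGraph V} {u v : V} (h : Unsat G)
    (huv : G.Adj u v) : Unsat (subdivideEdge G u v) := by
  classical
  obtain ⟨p, hp⟩ := h
  refine ⟨fun x y => match x, y with
    | some x, some y => p x y
    | some x, none => if x = u then p u v else p v u
    | none, some x => decide (x = u)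
    | none, none => false, fun τ hτ => hp (fun x => τ (some x)) ?_⟩
  have key : τ (some u) = p u v → τ (some v) ≠ p v u := by
    intro h1 h2
    have a1 := hτ (some u) none (subdivideEdge_adj_some_none.2 (Or.inl rfl))
    have a2 := hτ (some v) none (subdivideEdge_adj_some_none.2 (Or.inr rfl))
    simp [huv.ne'] at a1 a2
    simp [a1 h1] at a2
    exact a2 h2
  intro x y hxy hx hy
  by_cases he : s(x, y) = s(u, v)
  · rcases Sym2.eq_iff.1 he with ⟨rfl, rfl⟩ | ⟨rfl, rfl⟩
    · exact key hx hy
    · exact key hy hx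
  · exact hτ (some x) (some y) (subdivideEdge_adj_some_some.2 ⟨hxy, he⟩) hx hy

theorem Unsat.of_isSubdivision {V W : Type} {G : SimpleGraph V} {H : SimpleGraph W}
    (hGH : IsSubdivision G H) (h : Unsat G) : Unsat H := by
  induction hGH with
  | of_iso e => exact h.of_isSubgraphOf ⟨e, e.injective, fun _ _ => e.map_adj_iff.2⟩
  | step u v _ huv ih => exact (ih h).subdivideEdge huv

theorem Unsat.of_isTopMinor {V W : Type} {G : SimpleGraph V} {H : SimpleGraph W}
    (h : Unsat G) (hGH : IsTopMinor G H) : Unsat H := by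
  obtain ⟨γ, G', hs, hsub⟩ := hGH
  exact (Unsat.of_isSubdivision hs h).of_isSubgraphOf hsub

theorem unsat_butterfly : Unsat butterfly := by
  refine ⟨fun u v => decide ((u, v) ∈ [((0 : Fin 5), (1 : Fin 5)), (1, 2), (2, 3), (3, 4), (4, 2),
    (2, 4)]), fun τ h => ?_⟩
  have h01 := h 0 1 (by simp [butterfly])
  have h02 := h 0 2 (by simp [butterfly])
  have h12 := h 1 2 (by simp [butterfly])
  have h23 := h 2 3 (by simp [butterfly])
  have h24 := h 2 4 (by simp [butterfly])
  have h34 := h 3 4 (by simp [butterfly])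
  clear h
  simp at h01 h02 h12 h23 h24 h34
  cases h0 : τ 0 <;> cases h2 : τ 2 <;> cases h3 : τ 3 <;> simp_all

theorem unsat_bowtie : Unsat bowtie := by
  refine ⟨fun u v => decide ((u, v) ∈ [((0 : Fin 6), (1 : Fin 6)), (1, 2), (2, 3), (3, 2), (4, 5),
    (5, 3)]), fun τ h => ?_⟩
  have h01 := h 0 1 (by simp [bowtie])
  have h02 := h 0 2 (by simp [bowtie])
  have h12 := h 1 2 (by simp [bowtie])
  have h23 := h 2 3 (by simp [bowtie])
  have h34 := h 3 4 (by simp [bowtie])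
  have h35 := h 3 5 (by simp [bowtie])
  have h45 := h 4 5 (by simp [bowtie])
  clear h
  simp at h01 h02 h12 h23 h34 h35 h45
  cases h0 : τ 0 <;> cases h2 : τ 2 <;> cases h3 : τ 3 <;> simp_all

theorem unsat_K4 : Unsat K4 := by
  refine ⟨fun u v => decide ((u, v) ∈ [((0 : Fin 4), (1 : Fin 4)), (1, 2), (2, 3), (3, 0), (0, 2),
    (2, 0)]), fun τ h => ?_⟩
  have h01 := h 0 1 (by simp [K4])
  have h02 := h 0 2 (by simp [K4])
  have h03 := h 0 3 (by simp [K4])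
  have h12 := h 1 2 (by simp [K4])
  have h13 := h 1 3 (by simp [K4])
  have h23 := h 2 3 (by simp [K4])
  clear h
  simp at h01 h02 h03 h12 h13 h23
  cases h0 : τ 0 <;> cases h2 : τ 2 <;> cases h3 : τ 3 <;> simp_all

theorem unsat_K113 : Unsat K113 := by
  refine ⟨fun u v => decide ((u, v) ∈ [((0 : Fin 5), (3 : Fin 5)), (0, 4), (1, 2), (1, 4), (2, 0),
    (3, 0), (4, 0)]), fun τ h => ?_⟩
  have h01 := h 0 1 (by simp [K113])
  have h02 := h 0 2 (by simp [K113])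
  have h03 := h 0 3 (by simp [K113])
  have h04 := h 0 4 (by simp [K113])
  have h12 := h 1 2 (by simp [K113])
  have h13 := h 1 3 (by simp [K113])
  have h14 := h 1 4 (by simp [K113])
  clear h
  simp at h01 h02 h03 h04 h12 h13 h14
  cases h0 : τ 0 <;> cases h2 : τ 2 <;> cases h3 : τ 3 <;> simp_all

/-- One of the butterfly, the bowtie, `K₄` or `K_{1,1,3}` is a topological minor of `G`. -/
def HasUnsatMinor {V : Type} (G : SimpleGraph V) : Prop :=
  IsTopMinor butterfly G ∨ IsTopMinor bowtie G ∨ IsTopMinor K4 G ∨ IsTopMinor K113 G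

theorem IsTopMinor.of_le {V W : Type} {X : SimpleGraph W} {G H : SimpleGraph V}
    (h : IsTopMinor X G) (hGH : G ≤ H) : IsTopMinor X H := by
  obtain ⟨γ, X', hs, f, hf, hadj⟩ := h
  exact ⟨γ, X', hs, f, hf, fun u v huv => hGH (hadj huv)⟩

theorem IsTopMinor.of_isSubgraphOf {V W : Type} {X : SimpleGraph W} {G : SimpleGraph V}
    (h : IsSubgraphOf X G) : IsTopMinor X G :=
  ⟨W, X, .of_iso .refl, h⟩

theorem IsSubdivision.exists_adj {V W : Type} {G : SimpleGraph V} {H : SimpleGraph W}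
    (hGH : IsSubdivision G H) (h : ∀ x, ∃ y, G.Adj x y) : ∀ x, ∃ y, H.Adj x y := by
  induction hGH with
  | of_iso e =>
    intro x
    obtain ⟨y, hy⟩ := h (e.symm x)
    exact ⟨e y, by simpa using e.map_adj_iff.2 hy⟩
  | step u v _ huv ih =>
    rintro (_ | x)
    · exact ⟨some u, subdivideEdge_adj_none_some.2 (Or.inl rfl)⟩
    · by_cases hx : x = u ∨ x = v
      · exact ⟨none, subdivideEdge_adj_some_none.2 hx⟩
      · obtain ⟨y, hy⟩ := ih h x
        refine ⟨some y, subdivideEdge_adj_some_some.2 ⟨hy, fun he => hx ?_⟩⟩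
        rcases Sym2.eq_iff.1 he with h | h
        · exact Or.inl h.1
        · exact Or.inr h.1

/-- The graph obtained from `G` by isolating `w` and joining `a` to `b`. -/
def suppress {V : Type} (G : SimpleGraph V) (w a b : V) : SimpleGraph V :=
  G.deleteIncidenceSet w ⊔ SimpleGraph.edge a b

theorem suppress_adj {V : Type} {G : SimpleGraph V} {w a b x y : V} :
    (suppress G w a b).Adj x y ↔
      (G.Adj x y ∧ x ≠ w ∧ y ≠ w) ∨ ((x = a ∧ y = b ∨ x = b ∧ y = a) ∧ x ≠ y) := by
  rw [suppress, SimpleGraph.sup_adj, SimpleGraph.deleteIncidenceSet_adj, SimpleGraph.edge_adj]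

theorem IsTopMinor.of_suppress {V W : Type} {X : SimpleGraph W} {G : SimpleGraph V}
    (hX : ∀ x, ∃ y, X.Adj x y) {w a b : V} (haw : G.Adj a w) (hwb : G.Adj w b)
    (h : IsTopMinor X (suppress G w a b)) : IsTopMinor X G := by
  obtain ⟨γ, H, hs, g, hg, hadj⟩ := h
  have hgw : ∀ c, g c ≠ w := by
    intro c hc
    obtain ⟨d, hd⟩ := hs.exists_adj hX c
    rcases suppress_adj.1 (hadj hd) with h | ⟨⟨h, -⟩ | ⟨h, -⟩, -⟩
    · exact h.2.1 hc
    · exact haw.ne (h.symm.trans hc)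
    · exact hwb.ne' (h.symm.trans hc)
  by_cases he : ∃ x y, H.Adj x y ∧ g x = a ∧ g y = b
  · obtain ⟨x, y, hxy, rfl, rfl⟩ := he
    refine ⟨Option γ, subdivideEdge H x y, .step x y hs hxy, fun o => o.elim w g, ?_, ?_⟩
    · rintro (_ | c) (_ | d) hcd
      · rfl
      · exact absurd hcd.symm (hgw d)
      · exact absurd hcd (hgw c)
      · exact congrArg some (hg hcd)
    · rintro (_ | c) (_ | d) hcd
      · exact absurd hcd (SimpleGraph.irrefl _)
      · rcases subdivideEdge_adj_none_some.1 hcd with rfl | rfl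
        · exact haw.symm
        · exact hwb
      · rcases subdivideEdge_adj_some_none.1 hcd with rfl | rfl
        · exact haw
        · exact hwb.symm
      · obtain ⟨h1, h2⟩ := subdivideEdge_adj_some_some.1 hcd
        rcases suppress_adj.1 (hadj h1) with h | ⟨⟨h, h'⟩ | ⟨h, h'⟩, -⟩
        · exact h.1
        · exact absurd (by rw [hg h, hg h']) h2
        · exact absurd (by rw [hg h, hg h', Sym2.eq_swap]) h2
  · refine ⟨γ, H, hs, g, hg, fun c d hcd => ?_⟩
    rcases suppress_adj.1 (hadj hcd) with h | ⟨⟨h, h'⟩ | ⟨h, h'⟩, -⟩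
    · exact h.1
    · exact absurd ⟨c, d, hcd, h, h'⟩ he
    · exact absurd ⟨d, c, hcd.symm, h', h⟩ he

theorem HasUnsatMinor.of_le {V : Type} {G H : SimpleGraph V} (h : HasUnsatMinor G)
    (hGH : G ≤ H) : HasUnsatMinor H :=
  h.imp (·.of_le hGH) (.imp (·.of_le hGH) (.imp (·.of_le hGH) (·.of_le hGH)))

theorem HasUnsatMinor.of_suppress {V : Type} {G : SimpleGraph V} {w a b : V}
    (h : HasUnsatMinor (suppress G w a b)) (haw : G.Adj a w) (hwb : G.Adj w b) :
    HasUnsatMinor G := by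
  refine h.imp (.of_suppress ?_ haw hwb) (.imp (.of_suppress ?_ haw hwb)
    (.imp (.of_suppress ?_ haw hwb) (.of_suppress ?_ haw hwb)))
  · simp only [butterfly, SimpleGraph.fromEdgeSet_adj]
    decide
  · simp only [bowtie, SimpleGraph.fromEdgeSet_adj]
    decide
  · simp only [K4, SimpleGraph.top_adj]
    decide
  · simp only [K113, SimpleGraph.fromEdgeSet_adj]
    decide

theorem hasUnsatMinor_of_butterfly {V : Type} {G : SimpleGraph V} {a b c d e : V}
    (hnd : [a, b, c, d, e].Nodup) (hab : G.Adj a b) (hac : G.Adj a c) (hbc : G.Adj b c)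
    (hcd : G.Adj c d) (hce : G.Adj c e) (hde : G.Adj d e) : HasUnsatMinor G := by
  refine Or.inl (.of_isSubgraphOf ⟨[a, b, c, d, e].get, List.nodup_iff_injective_get.1 hnd, ?_⟩)
  intro x y h
  simp only [butterfly, SimpleGraph.fromEdgeSet_adj] at h
  fin_cases x <;> fin_cases y <;>
    first
    | (exfalso; revert h; decide)
    | assumption
    | (apply SimpleGraph.Adj.symm; assumption)

theorem hasUnsatMinor_of_bowtie {V : Type} {G : SimpleGraph V} {a b c d e f : V}
    (hnd : [a, b, c, d, e, f].Nodup) (hab : G.Adj a b) (hac : G.Adj a c) (hbc : G.Adj b c)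
    (hcd : G.Adj c d) (hde : G.Adj d e) (hdf : G.Adj d f) (hef : G.Adj e f) :
    HasUnsatMinor G := by
  refine Or.inr (Or.inl
    (.of_isSubgraphOf ⟨[a, b, c, d, e, f].get, List.nodup_iff_injective_get.1 hnd, ?_⟩))
  intro x y h
  simp only [bowtie, SimpleGraph.fromEdgeSet_adj] at h
  fin_cases x <;> fin_cases y <;>
    first
    | (exfalso; revert h; decide)
    | assumption
    | (apply SimpleGraph.Adj.symm; assumption)

theorem hasUnsatMinor_of_K4 {V : Type} {G : SimpleGraph V} {a b c d : V}
    (hnd : [a, b, c, d].Nodup) (hab : G.Adj a b) (hac : G.Adj a c) (had : G.Adj a d)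
    (hbc : G.Adj b c) (hbd : G.Adj b d) (hcd : G.Adj c d) : HasUnsatMinor G := by
  refine Or.inr (Or.inr (Or.inl
    (.of_isSubgraphOf ⟨[a, b, c, d].get, List.nodup_iff_injective_get.1 hnd, ?_⟩)))
  intro x y h
  simp only [K4, SimpleGraph.top_adj] at h
  fin_cases x <;> fin_cases y <;>
    first
    | (exfalso; revert h; decide)
    | assumption
    | (apply SimpleGraph.Adj.symm; assumption)

theorem hasUnsatMinor_of_K113 {V : Type} {G : SimpleGraph V} {a b c d e : V}
    (hnd : [a, b, c, d, e].Nodup) (hab : G.Adj a b) (hac : G.Adj a c) (had : G.Adj a d)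
    (hae : G.Adj a e) (hbc : G.Adj b c) (hbd : G.Adj b d) (hbe : G.Adj b e) :
    HasUnsatMinor G := by
  refine Or.inr (Or.inr (Or.inr
    (.of_isSubgraphOf ⟨[a, b, c, d, e].get, List.nodup_iff_injective_get.1 hnd, ?_⟩)))
  intro x y h
  simp only [K113, SimpleGraph.fromEdgeSet_adj] at h
  fin_cases x <;> fin_cases y <;>
    first
    | (exfalso; revert h; decide)
    | assumption
    | (apply SimpleGraph.Adj.symm; assumption)

theorem isChain_of_append_eq {V : Type} {R : V → V → Prop} {l m : List V} (h : l.IsChain R)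
    (s t : List V) (e : s ++ m ++ t = l) : m.IsChain R := by
  subst e
  exact (List.isChain_append.1 (List.isChain_append.1 h).1).2.1

/-- A path can be shortened to any subsequence of its vertices without creating new minors. -/
theorem exists_isChain_of_sublist {V : Type} {l' : List V} (n : ℕ) :
    ∀ (l : List V) (G : SimpleGraph V), l.length = n → l.Nodup → l'.Sublist l → l.IsChain G.Adj →
      ∃ G' : SimpleGraph V, l'.IsChain G'.Adj ∧ (∀ x ∈ l', ∀ y ∈ l', G.Adj x y → G'.Adj x y) ∧
        (HasUnsatMinor G' → HasUnsatMinor G) := by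
  classical
  induction n with
  | zero =>
    intro l G hl _ hsub hch
    exact ⟨G, isChain_of_append_eq hch [] [] (by simp_all), fun _ _ _ _ h => h, id⟩
  | succ n ih =>
    intro l G hl hnd hsub hch
    by_cases hw : ∀ w ∈ l, w ∈ l'
    · have := hsub.eq_of_length_le (List.subperm_of_subset hnd hw).length_le
      exact ⟨G, this ▸ hch, fun _ _ _ _ h => h, id⟩
    push Not at hw
    obtain ⟨w, hwl, hwl'⟩ := hw
    obtain ⟨s, t, rfl⟩ := List.append_of_mem hwl
    have hws : w ∉ s := fun h => by
      have := List.nodup_append.1 hnd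
      exact this.2.2 w h w (by simp) rfl
    have hwt : w ∉ t := ((List.nodup_append.1 hnd).2.1 |> List.nodup_cons.1).1
    have hsub' : l'.Sublist (s ++ t) := by
      have := hsub.erase w
      rwa [List.erase_of_not_mem hwl', List.erase_append_right _ hws, List.erase_cons_head] at this
    have hnd' : (s ++ t).Nodup := hnd.sublist (by simp)
    have hlen : (s ++ t).length = n := by simpa [← Nat.add_assoc] using hl
    rcases s.eq_nil_or_concat' with rfl | ⟨s, a, rfl⟩
    · exact ih t G hlen hnd' hsub' (isChain_of_append_eq hch [w] [] (by simp))
    rcases t with _ | ⟨b, t⟩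
    · exact ih _ G hlen hnd' hsub' (isChain_of_append_eq hch [] [w] (by simp))
    have haw : G.Adj a w := by
      have : [a, w].IsChain G.Adj := isChain_of_append_eq hch s (b :: t) (by simp)
      simpa using this
    have hwb : G.Adj w b := by
      have : [w, b].IsChain G.Adj := isChain_of_append_eq hch (s ++ [a]) t (by simp)
      simpa using this
    have hab : a ≠ b := (List.nodup_append.1 hnd').2.2 a (by simp) b (by simp)
    have hsup : ∀ x y, x ≠ w → y ≠ w → G.Adj x y → (suppress G w a b).Adj x y :=
      fun x y hx hy h => suppress_adj.2 (Or.inl ⟨h, hx, hy⟩)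
    obtain ⟨G', h1, h2, h3⟩ := ih ((s ++ [a]) ++ b :: t) (suppress G w a b) hlen hnd' hsub' <| by
      rw [List.append_assoc, List.singleton_append, List.isChain_append_cons_cons]
      refine ⟨?_, suppress_adj.2 (Or.inr (by simp [hab])), ?_⟩
      · refine List.IsChain.imp_of_mem_imp (fun x y hx hy h => hsup x y ?_ ?_ h)
          (isChain_of_append_eq hch [] (w :: b :: t) (by simp))
        · exact fun h => hws (h ▸ hx)
        · exact fun h => hws (h ▸ hy)
      · refine List.IsChain.imp_of_mem_imp (fun x y hx hy h => hsup x y ?_ ?_ h)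
          (isChain_of_append_eq hch (s ++ [a, w]) [] (by simp))
        · exact fun h => hwt (h ▸ hx)
        · exact fun h => hwt (h ▸ hy)
    refine ⟨G', h1, fun x hx y hy h => h2 x hx y hy (hsup x y ?_ ?_ h),
      fun h => (h3 h).of_suppress haw hwb⟩
    · exact fun h => hwl' (h ▸ hx)
    · exact fun h => hwl' (h ▸ hy)

/-- `v 0, …, v k` is a path of `G`. -/
structure IsPathUpTo {V : Type} (G : SimpleGraph V) (v : ℕ → V) (k : ℕ) : Prop where
  inj : ∀ i ≤ k, ∀ j ≤ k, v i = v j → i = j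
  adj : ∀ i < k, G.Adj (v i) (v (i + 1))

namespace IsPathUpTo

variable {V : Type} {G : SimpleGraph V} {v : ℕ → V} {k : ℕ}

theorem nodup_map (h : IsPathUpTo G v k) {m : List ℕ} (hm : m.Nodup) (hk : ∀ i ∈ m, i ≤ k) :
    (m.map v).Nodup :=
  hm.map_on fun i hi j hj => h.inj i (hk i hi) j (hk j hj)

theorem exists_isChain (h : IsPathUpTo G v k) {m : List ℕ} (hm : m.SortedLT)
    (hk : ∀ i ∈ m, i ≤ k) :
    ∃ G' : SimpleGraph V, (m.map v).IsChain G'.Adj ∧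
      (∀ i ∈ m, ∀ j ∈ m, G.Adj (v i) (v j) → G'.Adj (v i) (v j)) ∧
        (HasUnsatMinor G' → HasUnsatMinor G) := by
  have hsub : m.Sublist (List.range (k + 1)) := by
    refine List.sublist_of_subperm_of_sortedLE (List.subperm_of_subset hm.nodup fun i hi => ?_)
      hm.sortedLE List.pairwise_lt_range.sortedLT.sortedLE
    have := hk i hi
    simp only [List.mem_range]
    omega
  obtain ⟨G', h1, h2, h3⟩ := exists_isChain_of_sublist (l' := m.map v) _
    ((List.range (k + 1)).map v) G rfl (h.nodup_map List.nodup_range (by simp))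
    (hsub.map v) (by
      rw [List.isChain_map, List.isChain_range]
      exact fun i hi => h.adj i (by omega))
  exact ⟨G', h1, fun i hi j hj => h2 _ (List.mem_map_of_mem hi) _ (List.mem_map_of_mem hj), h3⟩

theorem exists_shrink_four (h : IsPathUpTo G v k) {a b c d : ℕ} (hab : a < b) (hbc : b < c) (hcd : c < d)
    (hdk : d ≤ k) :
    ∃ G' : SimpleGraph V, ([a, b, c, d].map v).Nodup ∧
      (G'.Adj (v a) (v b) ∧ G'.Adj (v b) (v c) ∧ G'.Adj (v c) (v d)) ∧
      (∀ i ∈ [a, b, c, d], ∀ j ∈ [a, b, c, d], G.Adj (v i) (v j) → G'.Adj (v i) (v j)) ∧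
        (HasUnsatMinor G' → HasUnsatMinor G) := by
  have hk : ∀ i ∈ [a, b, c, d], i ≤ k := by
    simp only [List.forall_mem_cons, List.not_mem_nil, false_imp_iff, implies_true, and_true]
    omega
  have hs : [a, b, c, d].SortedLT := by
    rw [List.sortedLT_iff_pairwise]
    simp only [List.pairwise_cons, List.forall_mem_cons, List.not_mem_nil, false_imp_iff,
      implies_true, and_true, List.Pairwise.nil]
    omega
  obtain ⟨G', h1, h2, h3⟩ := h.exists_isChain hs hk
  exact ⟨G', h.nodup_map hs.nodup hk, by simpa using h1, h2, h3⟩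

theorem exists_shrink_five (h : IsPathUpTo G v k) {a b c d e : ℕ} (hab : a < b) (hbc : b < c) (hcd : c < d) (hde : d < e)
    (hek : e ≤ k) :
    ∃ G' : SimpleGraph V, ([a, b, c, d, e].map v).Nodup ∧
      (G'.Adj (v a) (v b) ∧ G'.Adj (v b) (v c) ∧ G'.Adj (v c) (v d) ∧ G'.Adj (v d) (v e)) ∧
      (∀ i ∈ [a, b, c, d, e], ∀ j ∈ [a, b, c, d, e], G.Adj (v i) (v j) → G'.Adj (v i) (v j)) ∧
        (HasUnsatMinor G' → HasUnsatMinor G) := by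
  have hk : ∀ i ∈ [a, b, c, d, e], i ≤ k := by
    simp only [List.forall_mem_cons, List.not_mem_nil, false_imp_iff, implies_true, and_true]
    omega
  have hs : [a, b, c, d, e].SortedLT := by
    rw [List.sortedLT_iff_pairwise]
    simp only [List.pairwise_cons, List.forall_mem_cons, List.not_mem_nil, false_imp_iff,
      implies_true, and_true, List.Pairwise.nil]
    omega
  obtain ⟨G', h1, h2, h3⟩ := h.exists_isChain hs hk
  exact ⟨G', h.nodup_map hs.nodup hk, by simpa using h1, h2, h3⟩

theorem exists_shrink_six (h : IsPathUpTo G v k) {a b c d e f : ℕ} (hab : a < b) (hbc : b < c) (hcd : c < d) (hde : d < e) (hef : e < f)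
    (hfk : f ≤ k) :
    ∃ G' : SimpleGraph V, ([a, b, c, d, e, f].map v).Nodup ∧
      (G'.Adj (v a) (v b) ∧ G'.Adj (v b) (v c) ∧ G'.Adj (v c) (v d) ∧ G'.Adj (v d) (v e) ∧ G'.Adj (v e) (v f)) ∧
      (∀ i ∈ [a, b, c, d, e, f], ∀ j ∈ [a, b, c, d, e, f], G.Adj (v i) (v j) → G'.Adj (v i) (v j)) ∧
        (HasUnsatMinor G' → HasUnsatMinor G) := by
  have hk : ∀ i ∈ [a, b, c, d, e, f], i ≤ k := by
    simp only [List.forall_mem_cons, List.not_mem_nil, false_imp_iff, implies_true, and_true]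
    omega
  have hs : [a, b, c, d, e, f].SortedLT := by
    rw [List.sortedLT_iff_pairwise]
    simp only [List.pairwise_cons, List.forall_mem_cons, List.not_mem_nil, false_imp_iff,
      implies_true, and_true, List.Pairwise.nil]
    omega
  obtain ⟨G', h1, h2, h3⟩ := h.exists_isChain hs hk
  exact ⟨G', h.nodup_map hs.nodup hk, by simpa using h1, h2, h3⟩

theorem hasUnsatMinor_of_crossing (h : IsPathUpTo G v k) {a b c d : ℕ} (hab : a < b) (hbc : b < c) (hcd : c < d)
    (hdk : d ≤ k) (hac : G.Adj (v a) (v c)) (had : G.Adj (v a) (v d)) (hbd : G.Adj (v b) (v d)) :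
    HasUnsatMinor G := by
  obtain ⟨G', hnd, ⟨eab, ebc, ecd⟩, hG', hG⟩ :=
    h.exists_shrink_four hab hbc hcd hdk
  replace hac := hG' _ (by simp) _ (by simp) hac
  replace had := hG' _ (by simp) _ (by simp) had
  replace hbd := hG' _ (by simp) _ (by simp) hbd
  exact hG (hasUnsatMinor_of_K4 hnd eab hac had ebc hbd ecd)

theorem hasUnsatMinor_of_consecutive_triangles (h : IsPathUpTo G v k) {a b c d e : ℕ} (hab : a < b) (hbc : b < c) (hcd : c < d) (hde : d < e)
    (hek : e ≤ k) (hac : G.Adj (v a) (v c)) (hce : G.Adj (v c) (v e)) :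
    HasUnsatMinor G := by
  obtain ⟨G', hnd, ⟨eab, ebc, ecd, ede⟩, hG', hG⟩ :=
    h.exists_shrink_five hab hbc hcd hde hek
  replace hac := hG' _ (by simp) _ (by simp) hac
  replace hce := hG' _ (by simp) _ (by simp) hce
  exact hG (hasUnsatMinor_of_butterfly hnd eab hac ebc ecd hce ede)

theorem hasUnsatMinor_of_disjoint_triangles (h : IsPathUpTo G v k) {a b c d e f : ℕ} (hab : a < b) (hbc : b < c) (hcd : c < d) (hde : d < e) (hef : e < f)
    (hfk : f ≤ k) (hac : G.Adj (v a) (v c)) (hdf : G.Adj (v d) (v f)) :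
    HasUnsatMinor G := by
  obtain ⟨G', hnd, ⟨eab, ebc, ecd, ede, eef⟩, hG', hG⟩ :=
    h.exists_shrink_six hab hbc hcd hde hef hfk
  replace hac := hG' _ (by simp) _ (by simp) hac
  replace hdf := hG' _ (by simp) _ (by simp) hdf
  exact hG (hasUnsatMinor_of_bowtie hnd eab hac ebc ecd ede hdf eef)

theorem hasUnsatMinor_of_nested_triangles_left (h : IsPathUpTo G v k) {a b c d e : ℕ} (hab : a < b) (hbc : b < c) (hcd : c < d) (hde : d < e)
    (hek : e ≤ k) (hac : G.Adj (v a) (v c)) (had : G.Adj (v a) (v d)) (hae : G.Adj (v a) (v e)) (hbe : G.Adj (v b) (v e)) :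
    HasUnsatMinor G := by
  obtain ⟨G', hnd, ⟨eab, ebc, ecd, ede⟩, hG', hG⟩ :=
    h.exists_shrink_five hab hbc hcd hde hek
  replace hac := hG' _ (by simp) _ (by simp) hac
  replace had := hG' _ (by simp) _ (by simp) had
  replace hae := hG' _ (by simp) _ (by simp) hae
  replace hbe := hG' _ (by simp) _ (by simp) hbe
  have hnd' : [v c, v d, v a, v b, v e].Nodup := by
    simp only [List.map_cons, List.map_nil, List.nodup_cons, List.mem_cons, not_or] at hnd ⊢
    grind
  exact hG (hasUnsatMinor_of_butterfly hnd' ecd hac.symm had.symm eab hae hbe)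

theorem hasUnsatMinor_of_nested_triangles_right (h : IsPathUpTo G v k) {a b c d e : ℕ} (hab : a < b) (hbc : b < c) (hcd : c < d) (hde : d < e)
    (hek : e ≤ k) (had : G.Adj (v a) (v d)) (hae : G.Adj (v a) (v e)) (hbe : G.Adj (v b) (v e)) (hce : G.Adj (v c) (v e)) :
    HasUnsatMinor G := by
  obtain ⟨G', hnd, ⟨eab, ebc, ecd, ede⟩, hG', hG⟩ :=
    h.exists_shrink_five hab hbc hcd hde hek
  replace had := hG' _ (by simp) _ (by simp) had
  replace hae := hG' _ (by simp) _ (by simp) hae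
  replace hbe := hG' _ (by simp) _ (by simp) hbe
  replace hce := hG' _ (by simp) _ (by simp) hce
  have hnd' : [v b, v c, v e, v a, v d].Nodup := by
    simp only [List.map_cons, List.map_nil, List.nodup_cons, List.mem_cons, not_or] at hnd ⊢
    grind
  exact hG (hasUnsatMinor_of_butterfly hnd' ebc hbe hce hae.symm ede.symm had)

theorem hasUnsatMinor_of_overlapping_triangles_right (h : IsPathUpTo G v k) {a b c d e : ℕ} (hab : a < b) (hbc : b < c) (hcd : c < d) (hde : d < e)
    (hek : e ≤ k) (had : G.Adj (v a) (v d)) (hbd : G.Adj (v b) (v d)) (hce : G.Adj (v c) (v e)) :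
    HasUnsatMinor G := by
  obtain ⟨G', hnd, ⟨eab, ebc, ecd, ede⟩, hG', hG⟩ :=
    h.exists_shrink_five hab hbc hcd hde hek
  replace had := hG' _ (by simp) _ (by simp) had
  replace hbd := hG' _ (by simp) _ (by simp) hbd
  replace hce := hG' _ (by simp) _ (by simp) hce
  have hnd' : [v a, v b, v d, v c, v e].Nodup := by
    simp only [List.map_cons, List.map_nil, List.nodup_cons, List.mem_cons, not_or] at hnd ⊢
    grind
  exact hG (hasUnsatMinor_of_butterfly hnd' eab had hbd ecd.symm ede hce)

theorem hasUnsatMinor_of_overlapping_triangles_left (h : IsPathUpTo G v k) {a b c d e : ℕ} (hab : a < b) (hbc : b < c) (hcd : c < d) (hde : d < e)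
    (hek : e ≤ k) (hac : G.Adj (v a) (v c)) (hbd : G.Adj (v b) (v d)) (hbe : G.Adj (v b) (v e)) :
    HasUnsatMinor G := by
  obtain ⟨G', hnd, ⟨eab, ebc, ecd, ede⟩, hG', hG⟩ :=
    h.exists_shrink_five hab hbc hcd hde hek
  replace hac := hG' _ (by simp) _ (by simp) hac
  replace hbd := hG' _ (by simp) _ (by simp) hbd
  replace hbe := hG' _ (by simp) _ (by simp) hbe
  have hnd' : [v a, v c, v b, v d, v e].Nodup := by
    simp only [List.map_cons, List.map_nil, List.nodup_cons, List.mem_cons, not_or] at hnd ⊢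
    grind
  exact hG (hasUnsatMinor_of_butterfly hnd' hac eab ebc.symm hbd hbe ede)

theorem hasUnsatMinor_of_four_paths (h : IsPathUpTo G v k) {a b c d e : ℕ} (hab : a < b) (hbc : b < c) (hcd : c < d) (hde : d < e)
    (hek : e ≤ k) (had : G.Adj (v a) (v d)) (hbd : G.Adj (v b) (v d)) (hbe : G.Adj (v b) (v e)) :
    HasUnsatMinor G := by
  obtain ⟨G', hnd, ⟨eab, ebc, ecd, ede⟩, hG', hG⟩ :=
    h.exists_shrink_five hab hbc hcd hde hek
  replace had := hG' _ (by simp) _ (by simp) had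
  replace hbd := hG' _ (by simp) _ (by simp) hbd
  replace hbe := hG' _ (by simp) _ (by simp) hbe
  have hnd' : [v b, v d, v a, v c, v e].Nodup := by
    simp only [List.map_cons, List.map_nil, List.nodup_cons, List.mem_cons, not_or] at hnd ⊢
    grind
  exact hG (hasUnsatMinor_of_K113 hnd' hbd eab.symm ebc hbe had.symm ecd.symm ede)

theorem hasUnsatMinor_of_fan_left (h : IsPathUpTo G v k) {a b c d e : ℕ} (hab : a < b) (hbc : b < c) (hcd : c < d) (hde : d < e)
    (hek : e ≤ k) (hac : G.Adj (v a) (v c)) (had : G.Adj (v a) (v d)) (hae : G.Adj (v a) (v e)) :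
    HasUnsatMinor G := by
  obtain ⟨G', hnd, ⟨eab, ebc, ecd, ede⟩, hG', hG⟩ :=
    h.exists_shrink_five hab hbc hcd hde hek
  replace hac := hG' _ (by simp) _ (by simp) hac
  replace had := hG' _ (by simp) _ (by simp) had
  replace hae := hG' _ (by simp) _ (by simp) hae
  have hnd' : [v b, v c, v a, v d, v e].Nodup := by
    simp only [List.map_cons, List.map_nil, List.nodup_cons, List.mem_cons, not_or] at hnd ⊢
    grind
  exact hG (hasUnsatMinor_of_butterfly hnd' ebc eab.symm hac.symm had hae ede)

theorem hasUnsatMinor_of_fan_right (h : IsPathUpTo G v k) {a b c d e : ℕ} (hab : a < b) (hbc : b < c) (hcd : c < d) (hde : d < e)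
    (hek : e ≤ k) (hae : G.Adj (v a) (v e)) (hbe : G.Adj (v b) (v e)) (hce : G.Adj (v c) (v e)) :
    HasUnsatMinor G := by
  obtain ⟨G', hnd, ⟨eab, ebc, ecd, ede⟩, hG', hG⟩ :=
    h.exists_shrink_five hab hbc hcd hde hek
  replace hae := hG' _ (by simp) _ (by simp) hae
  replace hbe := hG' _ (by simp) _ (by simp) hbe
  replace hce := hG' _ (by simp) _ (by simp) hce
  have hnd' : [v a, v b, v e, v c, v d].Nodup := by
    simp only [List.map_cons, List.map_nil, List.nodup_cons, List.mem_cons, not_or] at hnd ⊢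
    grind
  exact hG (hasUnsatMinor_of_butterfly hnd' eab hae hbe hce.symm ede.symm ecd)

theorem hasUnsatMinor_of_inner_triangle_right (h : IsPathUpTo G v k) {a b c d e : ℕ} (hab : a < b) (hbc : b < c) (hcd : c < d) (hde : d < e)
    (hek : e ≤ k) (had : G.Adj (v a) (v d)) (hae : G.Adj (v a) (v e)) (hbd : G.Adj (v b) (v d)) :
    HasUnsatMinor G := by
  obtain ⟨G', hnd, ⟨eab, ebc, ecd, ede⟩, hG', hG⟩ :=
    h.exists_shrink_five hab hbc hcd hde hek
  replace had := hG' _ (by simp) _ (by simp) had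
  replace hae := hG' _ (by simp) _ (by simp) hae
  replace hbd := hG' _ (by simp) _ (by simp) hbd
  have hnd' : [v a, v e, v d, v b, v c].Nodup := by
    simp only [List.map_cons, List.map_nil, List.nodup_cons, List.mem_cons, not_or] at hnd ⊢
    grind
  exact hG (hasUnsatMinor_of_butterfly hnd' hae had ede.symm hbd.symm ecd.symm ebc)

theorem hasUnsatMinor_of_inner_triangle_left (h : IsPathUpTo G v k) {a b c d e : ℕ} (hab : a < b) (hbc : b < c) (hcd : c < d) (hde : d < e)
    (hek : e ≤ k) (hae : G.Adj (v a) (v e)) (hbe : G.Adj (v b) (v e)) (hbd : G.Adj (v b) (v d)) :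
    HasUnsatMinor G := by
  obtain ⟨G', hnd, ⟨eab, ebc, ecd, ede⟩, hG', hG⟩ :=
    h.exists_shrink_five hab hbc hcd hde hek
  replace hae := hG' _ (by simp) _ (by simp) hae
  replace hbe := hG' _ (by simp) _ (by simp) hbe
  replace hbd := hG' _ (by simp) _ (by simp) hbd
  have hnd' : [v a, v e, v b, v c, v d].Nodup := by
    simp only [List.map_cons, List.map_nil, List.nodup_cons, List.mem_cons, not_or] at hnd ⊢
    grind
  exact hG (hasUnsatMinor_of_butterfly hnd' hae eab hbe.symm ebc hbd ecd)

theorem hasUnsatMinor_of_inner_disjoint_triangle (h : IsPathUpTo G v k) {a b c d e f : ℕ} (hab : a < b) (hbc : b < c) (hcd : c < d) (hde : d < e) (hef : e < f)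
    (hfk : f ≤ k) (haf : G.Adj (v a) (v f)) (hbf : G.Adj (v b) (v f)) (hce : G.Adj (v c) (v e)) :
    HasUnsatMinor G := by
  obtain ⟨G', hnd, ⟨eab, ebc, ecd, ede, eef⟩, hG', hG⟩ :=
    h.exists_shrink_six hab hbc hcd hde hef hfk
  replace haf := hG' _ (by simp) _ (by simp) haf
  replace hbf := hG' _ (by simp) _ (by simp) hbf
  replace hce := hG' _ (by simp) _ (by simp) hce
  have hnd' : [v a, v b, v f, v e, v c, v d].Nodup := by
    simp only [List.map_cons, List.map_nil, List.nodup_cons, List.mem_cons, not_or] at hnd ⊢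
    grind
  exact hG (hasUnsatMinor_of_bowtie hnd' eab haf hbf eef.symm hce.symm ede.symm ecd)

theorem hasUnsatMinor_of_interlaced_triangles (h : IsPathUpTo G v k) {a b c d e f : ℕ} (hab : a < b) (hbc : b < c) (hcd : c < d) (hde : d < e) (hef : e < f)
    (hfk : f ≤ k) (had : G.Adj (v a) (v d)) (hae : G.Adj (v a) (v e)) (hbf : G.Adj (v b) (v f)) (hcf : G.Adj (v c) (v f)) :
    HasUnsatMinor G := by
  obtain ⟨G', hnd, ⟨eab, ebc, ecd, ede, eef⟩, hG', hG⟩ :=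
    h.exists_shrink_six hab hbc hcd hde hef hfk
  replace had := hG' _ (by simp) _ (by simp) had
  replace hae := hG' _ (by simp) _ (by simp) hae
  replace hbf := hG' _ (by simp) _ (by simp) hbf
  replace hcf := hG' _ (by simp) _ (by simp) hcf
  have hnd' : [v a, v e, v d, v c, v b, v f].Nodup := by
    simp only [List.map_cons, List.map_nil, List.nodup_cons, List.mem_cons, not_or] at hnd ⊢
    grind
  exact hG (hasUnsatMinor_of_bowtie hnd' hae had ede.symm ecd.symm ebc.symm hcf hbf)

theorem hasUnsatMinor_of_separated_chords (h : IsPathUpTo G v k) {a b c d : ℕ} (hab : a + 2 ≤ b)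
    (hbc : b ≤ c) (hcd : c + 2 ≤ d) (hdk : d ≤ k) (h₁ : G.Adj (v a) (v b))
    (h₂ : G.Adj (v c) (v d)) : HasUnsatMinor G := by
  rcases hbc.eq_or_lt with rfl | hbc
  · exact h.hasUnsatMinor_of_consecutive_triangles (b := a + 1) (d := b + 1) (by omega) (by omega)
      (by omega) (by omega) hdk h₁ h₂
  · exact h.hasUnsatMinor_of_disjoint_triangles (b := a + 1) (e := c + 1) (by omega) (by omega)
      (by omega) (by omega) (by omega) hdk h₁ h₂

theorem reverse (h : IsPathUpTo G v k) : IsPathUpTo G (fun i => v (k - i)) k where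
  inj i hi j hj hij := by
    have := h.inj _ (by omega) _ (by omega) hij
    omega
  adj i hi := by
    have := (h.adj (k - (i + 1)) (by omega)).symm
    rwa [show k - (i + 1) + 1 = k - i by omega] at this

theorem isChain (h : IsPathUpTo G v k) : ((List.range (k + 1)).map v).IsChain G.Adj := by
  rw [List.isChain_map, List.isChain_range]
  exact fun i hi => h.adj i (by omega)

theorem exists_eq_of_adj_zero (h : IsPathUpTo G v k)
    (hmax : ∀ l : List V, l.Nodup → l.IsChain G.Adj → l.length ≤ k + 1) {y : V}
    (hy : G.Adj (v 0) y) : ∃ j, 1 ≤ j ∧ j ≤ k ∧ y = v j := by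
  by_contra! hcon
  have hmem : y ∉ (List.range (k + 1)).map v := by
    intro hm
    obtain ⟨j, hj, rfl⟩ := List.mem_map.1 hm
    have hjk : j < k + 1 := List.mem_range.1 hj
    rcases j with _ | j
    · exact hy.ne rfl
    · exact hcon (j + 1) (by omega) (by omega) rfl
  have := hmax (y :: (List.range (k + 1)).map v)
    (List.nodup_cons.2 ⟨hmem, h.nodup_map List.nodup_range (by simp)⟩) (by
      have hc := h.isChain
      rw [List.range_succ_eq_map, List.map_cons] at hc ⊢
      exact List.isChain_cons_cons.2 ⟨hy.symm, hc⟩)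
  simp at this

theorem exists_eq_of_adj_last (h : IsPathUpTo G v k)
    (hmax : ∀ l : List V, l.Nodup → l.IsChain G.Adj → l.length ≤ k + 1) {y : V}
    (hy : G.Adj (v k) y) : ∃ j, j + 1 ≤ k ∧ y = v j := by
  obtain ⟨j, h1, h2, rfl⟩ := h.reverse.exists_eq_of_adj_zero hmax (by simpa using hy)
  exact ⟨k - j, by omega, rfl⟩

theorem rotate (h : IsPathUpTo G v k) (h0k : G.Adj (v 0) (v k)) :
    IsPathUpTo G (fun i => if i = 0 then v k else v (i - 1)) k where
  inj i hi j hj hij := by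
    split_ifs at hij with h1 h2 h2
    · omega
    · have := h.inj _ le_rfl _ (by omega) hij
      omega
    · have := h.inj _ (by omega) _ le_rfl hij
      omega
    · have := h.inj _ (by omega) _ (by omega) hij
      omega
  adj i hi := by
    rcases i with _ | i
    · simpa using h0k.symm
    · simpa using h.adj i (by omega)

end IsPathUpTo

/-- Every non-isolated vertex has degree at least three or exactly two, adjacent, neighbours. -/
def TrianglesAtDegreeTwo {V : Type} (G : SimpleGraph V) : Prop :=
  ∀ x y, G.Adj x y → ∃ z, z ≠ y ∧ G.Adj x z ∧ (G.Adj y z ∨ ∃ w, w ≠ y ∧ w ≠ z ∧ G.Adj x w)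

/-- `G` contains a four-cycle. -/
def HasFourCycle {V : Type} (G : SimpleGraph V) : Prop :=
  ∃ a b c d, [a, b, c, d].Nodup ∧ G.Adj a b ∧ G.Adj b c ∧ G.Adj c d ∧ G.Adj d a

namespace IsPathUpTo

variable {V : Type} {G : SimpleGraph V} {v : ℕ → V} {k : ℕ}

theorem exists_chord_zero (h : IsPathUpTo G v k) (hk : 1 ≤ k)
    (hmax : ∀ l : List V, l.Nodup → l.IsChain G.Adj → l.length ≤ k + 1)
    (hG : TrianglesAtDegreeTwo G) :
    ∃ i, 2 ≤ i ∧ i ≤ k ∧ G.Adj (v 0) (v i) ∧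
      (G.Adj (v 1) (v i) ∨ ∃ j, i < j ∧ j ≤ k ∧ G.Adj (v 0) (v j)) := by
  obtain ⟨z, hz1, hz, hor⟩ := hG (v 0) (v 1) (h.adj 0 hk)
  obtain ⟨i, hi1, hik, rfl⟩ := h.exists_eq_of_adj_zero hmax hz
  have hi : i ≠ 1 := fun e => hz1 (e ▸ rfl)
  rcases hor with h1 | ⟨w, hw1, hwi, hw⟩
  · exact ⟨i, by omega, hik, hz, Or.inl h1⟩
  · obtain ⟨j, hj1, hjk, rfl⟩ := h.exists_eq_of_adj_zero hmax hw
    have hj : j ≠ 1 := fun e => hw1 (e ▸ rfl)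
    have hji : j ≠ i := fun e => hwi (e ▸ rfl)
    rcases lt_or_gt_of_ne hji with hlt | hlt
    · exact ⟨j, by omega, hjk, hw, Or.inr ⟨i, hlt, hik, hz⟩⟩
    · exact ⟨i, by omega, hik, hz, Or.inr ⟨j, hlt, hjk, hw⟩⟩

theorem exists_chord_last (h : IsPathUpTo G v k) (hk : 1 ≤ k)
    (hmax : ∀ l : List V, l.Nodup → l.IsChain G.Adj → l.length ≤ k + 1)
    (hG : TrianglesAtDegreeTwo G) :
    ∃ a, a + 2 ≤ k ∧ G.Adj (v a) (v k) ∧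
      (G.Adj (v a) (v (k - 1)) ∨ ∃ b, b < a ∧ G.Adj (v b) (v k)) := by
  obtain ⟨i, hi2, hik, hi, hor⟩ := h.reverse.exists_chord_zero hk hmax hG
  simp only [Nat.sub_zero] at hi hor
  refine ⟨k - i, by omega, hi.symm, hor.imp (·.symm) ?_⟩
  rintro ⟨j, hij, hjk, hj⟩
  exact ⟨k - j, by omega, hj.symm⟩

theorem hasUnsatMinor_of_two_chords (h : IsPathUpTo G v k) {i j a b : ℕ} (hi : 2 ≤ i) (hij : i < j)
    (hjk : j ≤ k) (hba : b < a) (hak : a + 2 ≤ k) (h0i : G.Adj (v 0) (v i))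
    (h0j : G.Adj (v 0) (v j)) (hak' : G.Adj (v a) (v k)) (hbk : G.Adj (v b) (v k)) :
    HasUnsatMinor G := by
  by_cases hia : i ≤ a
  · exact h.hasUnsatMinor_of_separated_chords (by omega) hia hak le_rfl h0i hak'
  rcases Nat.eq_zero_or_pos b with rfl | hb
  · rcases hjk.eq_or_lt with rfl | hjk
    · exact h.hasUnsatMinor_of_crossing hba (by omega) hij le_rfl h0i h0j hak'
    · exact h.hasUnsatMinor_of_nested_triangles_left hba (by omega) hij hjk le_rfl h0i h0j hbk hak'
  · rcases hjk.eq_or_lt with rfl | hjk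
    · exact h.hasUnsatMinor_of_nested_triangles_right hb hba (by omega) hij le_rfl h0i h0j hbk hak'
    · exact h.hasUnsatMinor_of_interlaced_triangles hb hba (by omega) hij hjk le_rfl h0i h0j hbk
        hak'

theorem hasFourCycle (h : IsPathUpTo G v 3) (h03 : G.Adj (v 0) (v 3)) : HasFourCycle G := by
  refine ⟨v 0, v 1, v 2, v 3, h.nodup_map (m := [0, 1, 2, 3]) (by decide) (by simp), ?_⟩
  exact ⟨h.adj 0 (by omega), h.adj 1 (by omega), h.adj 2 (by omega), h03.symm⟩

theorem hasUnsatMinor_of_hamiltonian_triangle (h : IsPathUpTo G v k) (hk : 3 ≤ k)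
    (hmax : ∀ l : List V, l.Nodup → l.IsChain G.Adj → l.length ≤ k + 1)
    (hG : TrianglesAtDegreeTwo G) (h0k : G.Adj (v 0) (v k)) (h1k : G.Adj (v 1) (v k)) :
    HasUnsatMinor G ∨ k = 3 ∧ HasFourCycle G := by
  have hchord : ∀ c, c + 3 ≤ k → G.Adj (v (k - 1)) (v c) → HasUnsatMinor G := by
    intro c hc hadj
    rcases (by omega : c = 0 ∨ c = 1 ∨ 2 ≤ c) with rfl | rfl | hc2
    · exact h.hasUnsatMinor_of_crossing (b := 1) (by omega) (by omega) (by omega) le_rfl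
        hadj.symm h0k h1k
    · exact h.hasUnsatMinor_of_inner_triangle_left (b := 1) (c := 2) (by omega) (by omega)
        (by omega) (by omega) le_rfl h0k h1k hadj.symm
    · exact h.hasUnsatMinor_of_inner_disjoint_triangle (b := 1) (d := c + 1) (e := k - 1)
        (by omega) (by omega) (by omega) (by omega) (by omega) le_rfl h0k h1k hadj.symm
  have hnbr : ∀ y, G.Adj (v (k - 1)) y → y = v k ∨ ∃ c, c + 2 ≤ k ∧ y = v c := by
    intro y hy
    have hk0 : k ≠ 0 := by omega
    obtain ⟨j, hj, rfl⟩ := (h.rotate h0k).exists_eq_of_adj_last hmax (by simpa [hk0] using hy)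
    rcases j with _ | j
    · exact Or.inl (by simp)
    · exact Or.inr ⟨j, by omega, by simp⟩
  have hadj : G.Adj (v (k - 1)) (v (k - 2)) := by
    have := (h.adj (k - 2) (by omega)).symm
    rwa [show k - 2 + 1 = k - 1 by omega] at this
  have hne : ∀ c, v c ≠ v (k - 2) → c ≠ k - 2 := fun c hc e => hc (e ▸ rfl)
  obtain ⟨z, hz, hadjz, hor⟩ := hG _ _ hadj
  rcases hnbr z hadjz with rfl | ⟨c, hc, rfl⟩
  · rcases hor with h2 | ⟨w, hw, hwk, hadjw⟩
    · rcases hk.eq_or_lt with rfl | hk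
      · exact Or.inr ⟨rfl, h.hasFourCycle h0k⟩
      · exact Or.inl (h.hasUnsatMinor_of_fan_right (b := 1) (c := k - 2) (d := k - 1) (by omega)
          (by omega) (by omega) (by omega) le_rfl h0k h1k h2)
    · rcases hnbr w hadjw with rfl | ⟨c, hc, rfl⟩
      · exact absurd rfl hwk
      · have := hne c hw
        exact Or.inl (hchord c (by omega) hadjw)
  · have := hne c hz
    exact Or.inl (hchord c (by omega) hadjz)

theorem hasUnsatMinor_of_triangle_zero (h : IsPathUpTo G v k) (hk : 3 ≤ k)
    (hmax : ∀ l : List V, l.Nodup → l.IsChain G.Adj → l.length ≤ k + 1)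
    (hG : TrianglesAtDegreeTwo G) {i : ℕ} (hi : 2 ≤ i) (hik : i ≤ k) (h0i : G.Adj (v 0) (v i))
    (h1i : G.Adj (v 1) (v i)) : HasUnsatMinor G ∨ k = 3 ∧ HasFourCycle G := by
  obtain ⟨a, hak, hadj, hor⟩ := h.exists_chord_last (by omega) hmax hG
  by_cases hia : i ≤ a
  · exact Or.inl (h.hasUnsatMinor_of_separated_chords (by omega) hia hak le_rfl h0i hadj)
  rcases hik.eq_or_lt with rfl | hik
  · rcases (by omega : 2 ≤ a ∨ a = 1 ∨ a = 0) with ha | rfl | rfl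
    · exact Or.inl (h.hasUnsatMinor_of_fan_right (b := 1) (c := a) (d := i - 1) (by omega)
        (by omega) (by omega) (by omega) le_rfl h0i h1i hadj)
    · exact h.hasUnsatMinor_of_hamiltonian_triangle hk hmax hG h0i h1i
    · rcases hor with h0 | ⟨b, hb, -⟩
      · exact Or.inl (h.hasUnsatMinor_of_crossing (b := 1) (by omega) (by omega) (by omega) le_rfl
          h0 h0i h1i)
      · omega
  · rcases (by omega : 2 ≤ a ∨ a = 1 ∨ a = 0) with ha | rfl | rfl
    · exact Or.inl (h.hasUnsatMinor_of_overlapping_triangles_right (b := 1) (by omega) (by omega)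
        (by omega) hik le_rfl h0i h1i hadj)
    · rcases hi.eq_or_lt with rfl | hi
      · rcases hor with h1 | ⟨b, hb, hbk⟩
        · rcases hk.eq_or_lt with rfl | hk
          · refine Or.inr ⟨rfl, v 0, v 1, v 3, v 2,
              h.nodup_map (m := [0, 1, 3, 2]) (by decide) (by simp), ?_⟩
            exact ⟨h.adj 0 (by omega), hadj, (h.adj 2 (by omega)).symm, h0i.symm⟩
          · exact Or.inl (h.hasUnsatMinor_of_overlapping_triangles_left (d := k - 1) (by omega)
              (by omega) (by omega) (by omega) le_rfl h0i h1 hadj)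
        · obtain rfl : b = 0 := by omega
          exact Or.inl (h.hasUnsatMinor_of_crossing (by omega) (by omega) hik le_rfl h0i hbk hadj)
      · exact Or.inl (h.hasUnsatMinor_of_four_paths (c := 2) (by omega) (by omega) hi hik le_rfl
          h0i h1i hadj)
    · rcases hor with h0 | ⟨b, hb, -⟩
      · by_cases hik' : i = k - 1
        · rcases hk.eq_or_lt with rfl | hk
          · exact Or.inr ⟨rfl, h.hasFourCycle hadj⟩
          · subst hik'
            exact Or.inl (h.hasUnsatMinor_of_inner_triangle_right (b := 1) (c := 2) (by omega)
              (by omega) (by omega) (by omega) le_rfl h0i hadj h1i)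
        · exact Or.inl (h.hasUnsatMinor_of_fan_left (b := 1) (d := k - 1) (by omega)
            (by omega) (by omega) (by omega) le_rfl h0i h0 hadj)
      · omega

/-- A longest path yields one of the minors, unless it spans a very small component. -/
theorem hasUnsatMinor_of_longest (h : IsPathUpTo G v k) (hk : 1 ≤ k)
    (hmax : ∀ l : List V, l.Nodup → l.IsChain G.Adj → l.length ≤ k + 1)
    (hG : TrianglesAtDegreeTwo G) :
    HasUnsatMinor G ∨ (k = 3 ∧ HasFourCycle G) ∨ (k = 2 ∧ G.Adj (v 0) (v 2)) := by
  obtain ⟨i, hi, hik, h0i, hl⟩ := h.exists_chord_zero hk hmax hG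
  obtain ⟨a, hak, hadj, hr⟩ := h.exists_chord_last hk hmax hG
  by_cases hk3 : 3 ≤ k
  · rw [← or_assoc]
    refine Or.inl ?_
    rcases hl with h1i | ⟨j, hij, hjk, h0j⟩
    · exact h.hasUnsatMinor_of_triangle_zero hk3 hmax hG hi hik h0i h1i
    rcases hr with hr | ⟨b, hba, hbk⟩
    · refine h.reverse.hasUnsatMinor_of_triangle_zero (i := k - a) hk3 hmax hG (by omega)
        (by omega) ?_ ?_
      · simpa [show k - (k - a) = a by omega] using hadj.symm
      · simpa [show k - (k - a) = a by omega] using hr.symm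
    · exact Or.inl (h.hasUnsatMinor_of_two_chords hi hij hjk hba hak h0i h0j hadj hbk)
  · obtain rfl : k = 2 := by omega
    obtain rfl : i = 2 := by omega
    exact Or.inr (Or.inr ⟨rfl, h0i⟩)

end IsPathUpTo

theorem Unsat.delete_of_forall_adj_eq {V : Type} {G : SimpleGraph V} (h : Unsat G) {x y : V}
    (hx : ∀ z, G.Adj x z → z = y) : Unsat (G.deleteIncidenceSet x) := by
  classical
  obtain ⟨p, hp⟩ := h
  refine ⟨p, fun τ hτ => hp (Function.update τ x (!p x y)) fun u v huv => ?_⟩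
  by_cases hu : u = x
  · subst hu
    obtain rfl := hx v huv
    simp
  · by_cases hv : v = x
    · subst hv
      obtain rfl := hx u huv.symm
      simp
    · simpa [hu, hv] using hτ u v (SimpleGraph.deleteIncidenceSet_adj.2 ⟨huv, hu, hv⟩)

theorem Unsat.suppress {V : Type} {G : SimpleGraph V} (h : Unsat G) {w a b : V} (hab : a ≠ b)
    (hnadj : ¬ G.Adj a b) (hw : ∀ z, G.Adj w z → z = a ∨ z = b) : Unsat (suppress G w a b) := by
  classical
  obtain ⟨p, hp⟩ := h
  refine ⟨fun x y => if x = a ∧ y = b then p a w else if x = b ∧ y = a then p b w else p x y,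
    fun τ hτ => ?_⟩
  have key : ¬ (τ a = p a w ∧ τ b = p b w) := by
    have := hτ a b (suppress_adj.2 (Or.inr (by simp [hab])))
    simp [hab, hab.symm] at this
    tauto
  obtain ⟨t, hta, htb⟩ := exists_bool_avoiding (p w a) (p w b) _ _ _ _ key
  refine hp (Function.update τ w t) fun u v huv => ?_
  by_cases hu : u = w
  · subst hu
    have hne := huv.ne'
    rcases hw v huv with rfl | rfl <;> simpa [hne]
  · by_cases hv : v = w
    · subst hv
      have hne := huv.ne
      rcases hw u huv.symm with rfl | rfl <;> simp [hne] <;> tauto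
    · have := hτ u v (suppress_adj.2 (Or.inl ⟨huv, hu, hv⟩))
      have h1 : ¬ (u = a ∧ v = b) := by
        rintro ⟨rfl, rfl⟩
        exact hnadj huv
      have h2 : ¬ (u = b ∧ v = a) := by
        rintro ⟨rfl, rfl⟩
        exact hnadj huv.symm
      have h1' : ¬ (v = a ∧ u = b) := fun h => h2 h.symm
      have h2' : ¬ (v = b ∧ u = a) := fun h => h1 h.symm
      simpa [hu, hv, h1, h2, h1', h2'] using this

/-- A component contained in `K₄` minus an edge is irrelevant for satisfiability. -/
theorem Unsat.delete_small_component {V : Type} {G : SimpleGraph V} (h : Unsat G) {x y s t : V}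
    (hxy : x ≠ y) (hs : ∀ z, G.Adj s z → z = x ∨ z = y) (ht : ∀ z, G.Adj t z → z = x ∨ z = y)
    (hx : ∀ z, G.Adj x z → z = y ∨ z = s ∨ z = t) (hy : ∀ z, G.Adj y z → z = x ∨ z = s ∨ z = t) :
    Unsat ((G.deleteIncidenceSet x).deleteIncidenceSet y) := by
  classical
  obtain ⟨p, hp⟩ := h
  refine ⟨p, fun τ hτ => ?_⟩
  have hbool : ∀ a b c d e f : Bool, ∃ m n : Bool, ¬ (m = a ∧ n = b) ∧ ¬ (m = c ∧ n = d) ∧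
      ¬ (m = e ∧ n = f) := by decide
  obtain ⟨m, n, hms, hmt, hmn⟩ := hbool (p x s) (p y s) (p x t) (p y t) (p x y) (p y x)
  have hg : ∀ z, ∃ r : Bool, z = s ∨ z = t → (r = p z x → m ≠ p x z) ∧ (r = p z y → n ≠ p y z) := by
    intro z
    by_cases hz : z = s ∨ z = t
    · obtain ⟨r, hr⟩ := exists_bool_avoiding (p z x) (p z y) (p x z) (p y z) m n (by
        rcases hz with rfl | rfl <;> assumption)
      exact ⟨r, fun _ => hr⟩
    · exact ⟨true, fun h => absurd h hz⟩
  choose g hg using hg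
  have hxadj : ∀ z, G.Adj x z → z ≠ y → z = s ∨ z = t := fun z hz hzy =>
    (hx z hz).resolve_left hzy
  have hyadj : ∀ z, G.Adj y z → z ≠ x → z = s ∨ z = t := fun z hz hzx =>
    (hy z hz).resolve_left hzx
  have hst : ∀ z, z = s ∨ z = t → ∀ u, G.Adj z u → u = x ∨ u = y := by
    rintro z (rfl | rfl) u hu
    · exact hs u hu
    · exact ht u hu
  have hyx := hxy.symm
  let σ : V → Bool := fun z =>
    if z = x then m else if z = y then n else if z = s ∨ z = t then g z else τ z
  have hσx : σ x = m := by simp [σ]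
  have hσy : σ y = n := by simp [σ, hyx]
  have hσg : ∀ z, z ≠ x → z ≠ y → z = s ∨ z = t → σ z = g z := fun z h1 h2 h3 => by
    simp only [σ, if_neg h1, if_neg h2, if_pos h3]
  have hσx' : ∀ z, G.Adj x z → z ≠ y → σ z = p z x → σ x ≠ p x z := by
    intro z hz hzy
    rw [hσg z hz.ne' hzy (hxadj z hz hzy), hσx]
    exact (hg z (hxadj z hz hzy)).1
  have hσy' : ∀ z, G.Adj y z → z ≠ x → σ z = p z y → σ y ≠ p y z := by
    intro z hz hzx
    rw [hσg z hzx hz.ne' (hyadj z hz hzx), hσy]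
    exact (hg z (hyadj z hz hzx)).2
  refine hp σ fun u v huv hu hv => ?_
  by_cases hux : u = x
  · subst hux
    by_cases hvy : v = y
    · subst hvy
      exact hmn ⟨hσx ▸ hu, hσy ▸ hv⟩
    · exact hσx' v huv hvy hv hu
  by_cases huy : u = y
  · subst huy
    by_cases hvx : v = x
    · subst hvx
      exact hmn ⟨hσx ▸ hv, hσy ▸ hu⟩
    · exact hσy' v huv hvx hv hu
  by_cases hvx : v = x
  · subst hvx
    exact hσx' u huv.symm huy hu hv
  by_cases hvy : v = y
  · subst hvy
    exact hσy' u huv.symm hux hu hv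
  have hu' : ¬ (u = s ∨ u = t) := fun h => (hst u h v huv).elim hvx hvy
  have hv' : ¬ (v = s ∨ v = t) := fun h => (hst v h u huv.symm).elim hux huy
  have hσu : σ u = τ u := by simp only [σ, if_neg hux, if_neg huy, if_neg hu']
  have hσv : σ v = τ v := by simp only [σ, if_neg hvx, if_neg hvy, if_neg hv']
  exact hτ u v (SimpleGraph.deleteIncidenceSet_adj.2
    ⟨SimpleGraph.deleteIncidenceSet_adj.2 ⟨huv, hux, hvx⟩, huy, hvy⟩) (hσu ▸ hu) (hσv ▸ hv)

theorem Unsat.exists_adj {V : Type} {G : SimpleGraph V} (h : Unsat G) : ∃ u v, G.Adj u v := by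
  by_contra! hcon
  obtain ⟨p, hp⟩ := h
  exact hp (fun _ => true) fun u v huv => absurd huv (hcon u v)

/-- A graph with an edge has a longest path. -/
theorem exists_longest_path {V : Type} [Fintype V] {G : SimpleGraph V} {x y : V}
    (hxy : G.Adj x y) : ∃ (v : ℕ → V) (k : ℕ), 1 ≤ k ∧ IsPathUpTo G v k ∧
      ∀ l : List V, l.Nodup → l.IsChain G.Adj → l.length ≤ k + 1 := by
  classical
  let P : ℕ → Prop := fun n => ∃ l : List V, l.Nodup ∧ l.IsChain G.Adj ∧ l.length = n
  have hbd : ∀ n, P n → n ≤ Fintype.card V := by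
    rintro n ⟨l, hl, -, rfl⟩
    exact hl.length_le_card
  have h2 : P 2 := ⟨[x, y], by simp [hxy.ne], by simp [hxy], rfl⟩
  obtain ⟨l, hnd, hch, hlen⟩ := Nat.findGreatest_spec (hbd 2 h2) h2
  have hle := Nat.le_findGreatest (hbd 2 h2) h2
  have hget : ∀ i (hi : i < l.length), l.getD i x = l[i] := fun i hi => by simp [hi]
  refine ⟨fun i => l.getD i x, l.length - 1, by omega, ⟨?_, ?_⟩, ?_⟩
  · intro i hi j hj hij
    simp only [hget i (by omega), hget j (by omega)] at hij
    exact (hnd.getElem_inj_iff).1 hij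
  · intro i hi
    simp only [hget i (by omega), hget (i + 1) (by omega)]
    exact List.isChain_iff_getElem.1 hch i (by omega)
  · intro l' hnd' hch'
    have := Nat.le_findGreatest (hbd _ ⟨l', hnd', hch', rfl⟩) (P := P) ⟨l', hnd', hch', rfl⟩
    omega

theorem mem_of_adj_head {V : Type} {G : SimpleGraph V} {n : ℕ}
    (hmax : ∀ l : List V, l.Nodup → l.IsChain G.Adj → l.length ≤ n) {x y : V} {l : List V}
    (hnd : (x :: l).Nodup) (hch : (x :: l).IsChain G.Adj) (hlen : (x :: l).length = n)
    (hxy : G.Adj x y) : y ∈ l := by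
  by_contra hy
  have := hmax (y :: x :: l) (List.nodup_cons.2 ⟨by simp [hxy.ne', hy], hnd⟩)
    (List.isChain_cons_cons.2 ⟨hxy.symm, hch⟩)
  simp only [List.length_cons] at this hlen
  omega

theorem hasUnsatMinor_of_unsat {V : Type} [Fintype V] (n : ℕ) :
    ∀ G : SimpleGraph V, G.support.ncard = n → Unsat G → HasUnsatMinor G := by
  classical
  induction n using Nat.strong_induction_on with
  | _ n ih =>
  intro G hn hG
  have hlt : ∀ (G' : SimpleGraph V) (x y : V), G.Adj x y → (∀ z, ¬ G'.Adj x z) →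
      G'.support ⊆ G.support → Unsat G' → HasUnsatMinor G' := by
    intro G' x y hxy hx hsub hU
    refine ih _ ?_ G' rfl hU
    rw [← hn]
    refine Set.ncard_lt_ncard ((Set.ssubset_iff_of_subset hsub).2 ⟨x, ⟨y, hxy⟩, ?_⟩)
    rintro ⟨z, hz⟩
    exact hx z hz
  by_contra hcon
  have hdel : ∀ x, G.deleteIncidenceSet x ≤ G := fun x _ _ h =>
    (SimpleGraph.deleteIncidenceSet_adj.1 h).1
  have htri : TrianglesAtDegreeTwo G := by
    intro x y hxy
    by_contra! hno
    by_cases hz : ∃ z, z ≠ y ∧ G.Adj x z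
    · obtain ⟨z, hzy, hxz⟩ := hz
      obtain ⟨hyz, hw⟩ := hno z hzy hxz
      refine hcon (HasUnsatMinor.of_suppress (w := x) (a := y) (b := z)
        (hlt _ x y hxy ?_ ?_ (hG.suppress hzy.symm hyz fun u hu => ?_)) hxy.symm hxz)
      · intro u hu
        rcases suppress_adj.1 hu with h | ⟨⟨h, -⟩ | ⟨h, -⟩, -⟩
        · exact h.2.1 rfl
        · exact hxy.ne h
        · exact hxz.ne h
      · rintro u ⟨u', hu⟩
        rcases suppress_adj.1 hu with h | ⟨⟨rfl, -⟩ | ⟨rfl, -⟩, -⟩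
        · exact ⟨u', h.1⟩
        · exact ⟨x, hxy.symm⟩
        · exact ⟨x, hxz.symm⟩
      · by_contra! hne
        exact hw u hne.1 hne.2 hu
    · push Not at hz
      refine hcon (HasUnsatMinor.of_le (hlt _ x y hxy ?_ ?_
        (hG.delete_of_forall_adj_eq (x := x) (y := y) fun z hxz => ?_)) (hdel x))
      · exact fun z h => (SimpleGraph.deleteIncidenceSet_adj.1 h).2.1 rfl
      · exact SimpleGraph.support_mono (hdel x)
      · by_contra hne
        exact hz z hne hxz
  have hsmall : ∀ x y s t : V, x ≠ y → G.Adj y t → (∀ z, G.Adj s z → z = x ∨ z = y) →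
      (∀ z, G.Adj t z → z = x ∨ z = y) → (∀ z, G.Adj x z → z = y ∨ z = s ∨ z = t) →
      (∀ z, G.Adj y z → z = x ∨ z = s ∨ z = t) → False := by
    intro x y s t hxy hyt hs ht hx hy
    have hle : (G.deleteIncidenceSet x).deleteIncidenceSet y ≤ G := fun u u' h =>
      hdel x (SimpleGraph.deleteIncidenceSet_adj.1 h).1
    refine hcon (HasUnsatMinor.of_le (hlt _ y t hyt ?_ (SimpleGraph.support_mono hle)
      (hG.delete_small_component hxy hs ht hx hy)) hle)
    exact fun z h => (SimpleGraph.deleteIncidenceSet_adj.1 h).2.1 rfl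
  obtain ⟨x, y, hxy⟩ := hG.exists_adj
  obtain ⟨v, k, hk, hv, hmax⟩ := exists_longest_path hxy
  rcases hv.hasUnsatMinor_of_longest hk hmax htri with
    h | ⟨rfl, a, b, c, d, hnd, hab, hbc, hcd, hda⟩ | ⟨rfl, h02⟩
  · exact hcon h
  · have ha : ∀ z, G.Adj a z → z ∈ [b, c, d] := fun z => mem_of_adj_head hmax hnd
      (by simp [hab, hbc, hcd]) rfl
    have hb : ∀ z, G.Adj b z → z ∈ [c, d, a] := fun z => mem_of_adj_head hmax
      ((List.rotate_perm [a, b, c, d] 1).nodup_iff.2 hnd) (by simp [hda, hbc, hcd]) rfl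
    have hc : ∀ z, G.Adj c z → z ∈ [d, a, b] := fun z => mem_of_adj_head hmax
      ((List.rotate_perm [a, b, c, d] 2).nodup_iff.2 hnd) (by simp [hda, hab, hcd]) rfl
    have hd : ∀ z, G.Adj d z → z ∈ [a, b, c] := fun z => mem_of_adj_head hmax
      ((List.rotate_perm [a, b, c, d] 3).nodup_iff.2 hnd) (by simp [hda, hab, hbc]) rfl
    simp only [List.mem_cons, List.not_mem_nil, or_false] at ha hb hc hd
    by_cases hac : G.Adj a c
    · by_cases hbd : G.Adj b d
      · exact hcon (hasUnsatMinor_of_K4 hnd hab hac hda.symm hbc hbd hcd)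
      · refine hsmall a c b d hac.ne hcd (fun z hz => ?_) (fun z hz => ?_) (fun z hz => ?_)
          (fun z hz => ?_)
        · rcases hb z hz with rfl | rfl | rfl <;> simp_all
        · have hdb : ¬ G.Adj d b := fun h => hbd h.symm
          rcases hd z hz with rfl | rfl | rfl <;> simp_all
        · have := ha z hz
          tauto
        · have := hc z hz
          tauto
    · have hca : ¬ G.Adj c a := fun h => hac h.symm
      have hbd : b ≠ d := by
        rintro rfl
        simp at hnd
      refine hsmall b d a c hbd hcd.symm (fun z hz => ?_) (fun z hz => ?_) (fun z hz => ?_)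
        (fun z hz => ?_)
      · rcases ha z hz with rfl | rfl | rfl <;> simp_all
      · rcases hc z hz with rfl | rfl | rfl <;> simp_all
      · have := hb z hz
        tauto
      · have := hd z hz
        tauto
  · have h01 : G.Adj (v 0) (v 1) := hv.adj 0 (by omega)
    have h12 : G.Adj (v 1) (v 2) := hv.adj 1 (by omega)
    have hnd : [v 0, v 1, v 2].Nodup := hv.nodup_map (m := [0, 1, 2]) (by decide) (by simp)
    have h0 : ∀ z, G.Adj (v 0) z → z ∈ [v 1, v 2] := fun z => mem_of_adj_head hmax hnd
      (by simp [h01, h12]) rfl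
    have h1 : ∀ z, G.Adj (v 1) z → z ∈ [v 2, v 0] := fun z => mem_of_adj_head hmax
      ((List.rotate_perm [v 0, v 1, v 2] 1).nodup_iff.2 hnd) (by simp [h02.symm, h12]) rfl
    have h2 : ∀ z, G.Adj (v 2) z → z ∈ [v 0, v 1] := fun z => mem_of_adj_head hmax
      ((List.rotate_perm [v 0, v 1, v 2] 2).nodup_iff.2 hnd) (by simp [h02.symm, h01]) rfl
    simp only [List.mem_cons, List.not_mem_nil, or_false] at h0 h1 h2
    refine hsmall (v 1) (v 2) (v 0) (v 0) h12.ne h02.symm h0 h0 (fun z hz => ?_) (fun z hz => ?_)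
    · have := h1 z hz
      tauto
    · have := h2 z hz
      tauto

/-- A finite simple graph `G` is in `𝒰` iff at least one of the butterfly, the
bowtie, `K₄` or `K_{1,1,3}` is a topological minor of `G`. -/
theorem stmt_19 {α : Type} [Fintype α] (G : SimpleGraph α) :
    InU G ↔ (IsTopMinor butterfly G ∨ IsTopMinor bowtie G ∨
      IsTopMinor K4 G ∨ IsTopMinor K113 G) := by
  refine ⟨fun h => hasUnsatMinor_of_unsat _ G rfl (unsat_of_inU h), ?_⟩
  rintro (h | h | h | h)
  · exact inU_of_unsat (unsat_butterfly.of_isTopMinor h)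
  · exact inU_of_unsat (unsat_bowtie.of_isTopMinor h)
  · exact inU_of_unsat (unsat_K4.of_isTopMinor h)
  · exact inU_of_unsat (unsat_K113.of_isTopMinor h)

end Sat2
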